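/- arXiv:0902.3526 — 4 statements merged into one kernel-verified Lean document; each statement's English description precedes it below -/
import Mathlib

section
/- In the Markovian-constraint setting (see context), assume A = { (x_1,...,x_M) ∈ X^M : S̄(x_1,...,x_M) ≠ ⋆ } is nonempty and let p be the distribution on X^M supported on A with p(x) = 1{x ∈ A} exp(−η Σ_{j=1}^M L^{(j)}(x_j)) / Σ_{a ∈ A} exp(−η Σ_{j=1}^M L^{(j)}(a_j)). Then for every a ∈ X, the probability under p that the M-th coordinate equals a is ( Σ_{s∈S} w_{M,a,s} ) / ( Σ_{a'∈X} Σ_{s∈S} w_{M,a',s} ). -/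
/-- Summing over tuples with prescribed last entry is summing over the initial segment. -/
theorem sum_filter_last_eq_sum_snoc {X : Type*} [Fintype X] [DecidableEq X] {n : ℕ}
    (g : (Fin (n + 1) → X) → ℝ) (a : X) :
    ∑ v ∈ Finset.univ.filter (fun v : Fin (n + 1) → X => v (Fin.last n) = a), g v =
      ∑ q : Fin n → X, g (Fin.snoc q a) := by
  symm
  refine Finset.sum_bij' (fun q _ => Fin.snoc q a) (fun v _ => Fin.init v) ?_ ?_ ?_ ?_ ?_
  · simp
  · simp
  · simp
  · intro v hv
    obtain rfl := (Finset.mem_filter.mp hv).2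
    exact Fin.snoc_init_self v
  · simp


open Finset Classical in
theorem stmt7 {X S : Type*} [Fintype X] [Fintype S]
    (σ : X → Option S) (f : X → Option S → X → Option S)
    (hf : ∀ x x', f x none x' = none)
    (Sbar : (j : ℕ) → (Fin j → X) → Option S)
    (hSbar1 : ∀ x : Fin 1 → X, Sbar 1 x = σ (x 0))
    (hSbarS : ∀ (j : ℕ) (x : Fin (j + 2) → X),
      Sbar (j + 2) x = f (x ((Fin.last j).castSucc))
        (Sbar (j + 1) (fun i => x i.castSucc)) (x (Fin.last (j + 1))))
    (η : ℝ) (hη : 0 < η) (M : ℕ) (hM : 1 ≤ M) (L : Fin M → X → ℝ)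
    (w : Fin M → X → S → ℝ)
    (hw : ∀ (j : Fin M) (x : X) (s : S), w j x s =
      ∑ q : Fin j.1 → X,
        Real.exp (-η * (L j x + ∑ i : Fin j.1, L (i.castLE j.isLt.le) (q i))) *
          (if Sbar (j.1 + 1) (Fin.snoc q x) = some s then 1 else 0))
    (hA : ∃ v : Fin M → X, Sbar M v ≠ none)
    (p : (Fin M → X) → ℝ)
    (hp : ∀ v, p v =
      (if Sbar M v ≠ none then Real.exp (-η * ∑ j, L j (v j)) else 0) /
        ∑ a : Fin M → X,
          (if Sbar M a ≠ none then Real.exp (-η * ∑ j, L j (a j)) else 0))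
    (a : X) :
    ∑ v ∈ Finset.univ.filter (fun v : Fin M → X => v ⟨M - 1, by omega⟩ = a), p v =
      (∑ s : S, w ⟨M - 1, by omega⟩ a s) /
        ∑ a' : X, ∑ s : S, w ⟨M - 1, by omega⟩ a' s := by
  obtain ⟨n, rfl⟩ : ∃ n, M = n + 1 := ⟨M - 1, by omega⟩
  set g : (Fin (n + 1) → X) → ℝ := fun v =>
    if Sbar (n + 1) v ≠ none then Real.exp (-η * ∑ j, L j (v j)) else 0 with hg
  have weight_sum (x : X) : ∑ s : S, w (Fin.last n) x s = ∑ q : Fin n → X, g (Fin.snoc q x) := by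
    simp only [hw]
    rw [Finset.sum_comm]
    refine Finset.sum_congr rfl fun q _ => ?_
    rw [← Finset.mul_sum]
    have hexp : L (Fin.last n) x + ∑ i : Fin n, L i.castSucc (q i) =
        ∑ j, L j ((Fin.snoc q x : Fin (n + 1) → X) j) := by
      rw [Fin.sum_univ_castSucc, add_comm]
      simp
    change Real.exp (-η * (L (Fin.last n) x + ∑ i : Fin n, L i.castSucc (q i))) *
      (∑ s : S, if Sbar (n + 1) (Fin.snoc q x) = some s then (1 : ℝ) else 0) = _
    rw [hexp]
    simp only [hg]
    cases Sbar (n + 1) (Fin.snoc q x) <;> simp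
  change ∑ v ∈ Finset.univ.filter (fun v : Fin (n + 1) → X => v (Fin.last n) = a), p v =
    (∑ s : S, w (Fin.last n) a s) / ∑ a' : X, ∑ s : S, w (Fin.last n) a' s
  have total : ∑ v, g v = ∑ x : X, ∑ s : S, w (Fin.last n) x s := by
    simp only [weight_sum, ← sum_filter_last_eq_sum_snoc]
    exact (Finset.sum_fiberwise _ _ _).symm
  have hp' (v) : p v = g v / ∑ u, g u := hp v
  simp only [hp']
  rw [← Finset.sum_div, total, weight_sum a, ← sum_filter_last_eq_sum_snoc]
end

section
/- In the Markovian-constraint setting (see context), assume A = { (x_1,...,x_M) ∈ X^M : S̄(x_1,...,x_M) ≠ ⋆ } is nonempty, let (X_1, ..., X_M) be a random vector with the Gibbs distribution p(x) ∝ 1{x ∈ A} exp(−η Σ_{j=1}^M L^{(j)}(x_j)), and set S_j = S̄(X_1,...,X_j) for 1 ≤ j ≤ M. Then for every 1 ≤ j ≤ M−1, every suffix (a_{j+1}, s_{j+1}, ..., a_M, s_M) ∈ (X × S)^{M−j} such that the event E = { X_i = a_i and S_i = s_i for all i = j+1, ..., M } has positive probability, and every (a, s) ∈ X × S, the conditional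 probability P( X_j = a, S_j = s | E ) equals w_{j,a,s} · 1{ f(a, s, a_{j+1}) = s_{j+1} } / Σ_{(a',s') ∈ X × S} w_{j,a',s'} · 1{ f(a', s', a_{j+1}) = s_{j+1} }; in particular it depends on the suffix only through (a_{j+1}, s_{j+1}). -/
theorem Fin.sum_univ_eq_add_sum_ite_lt {M : ℕ} (j : ℕ) (hj : j < M) (g : Fin M → ℝ) :
    ∑ i, g i = (g ⟨j, hj⟩ + ∑ i : Fin j, g (i.castLE hj.le)) +
      ∑ i, if j < i.1 then g i else 0 := by
  obtain ⟨k, rfl⟩ := Nat.exists_eq_add_of_le (Nat.succ_le_of_lt hj)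
  rw [Fin.sum_univ_add g, Fin.sum_univ_add (fun i => if j < i.1 then g i else 0),
    Fin.sum_univ_castSucc]
  have h₁ : ∀ i : Fin (j + 1), ¬ j < (Fin.castAdd k i).1 := fun i => by
    have := i.isLt
    simp only [Fin.val_castAdd]
    omega
  have h₂ : ∀ i : Fin k, j < (Fin.natAdd (j + 1) i).1 := fun i => by
    simp only [Fin.val_natAdd]
    omega
  simp only [h₁, h₂, if_true, if_false, Finset.sum_const_zero, zero_add]
  rw [add_comm (g ⟨j, hj⟩)]
  rfl

/-- The sequence with prefix `q`, entry `a` at position `j`, and entries of `b` afterwards. -/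
def gluePrefix {X : Type*} {M : ℕ} (j : ℕ) (q : Fin j → X) (a : X) (b : Fin M → X) :
    Fin M → X :=
  fun i => if h : i.1 < j then q ⟨i.1, h⟩ else if i.1 = j then a else b i

section gluePrefix

variable {X : Type*} {M j : ℕ} (q : Fin j → X) (a : X) (b : Fin M → X)

theorem gluePrefix_castLE (hj : j ≤ M) (i : Fin j) :
    gluePrefix j q a b (i.castLE hj) = q i := by
  simp [gluePrefix]

theorem gluePrefix_self (hj : j < M) : gluePrefix j q a b ⟨j, hj⟩ = a := by
  simp [gluePrefix]

theorem gluePrefix_of_lt {i : Fin M} (hi : j < i.1) : gluePrefix j q a b i = b i := by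
  have h₁ : ¬ i.1 < j := by omega
  have h₂ : i.1 ≠ j := by omega
  simp [gluePrefix, h₁, h₂]

theorem gluePrefix_comp_castLE (hj : j + 1 ≤ M) :
    (fun t : Fin (j + 1) => gluePrefix j q a b (Fin.castLE hj t)) =
      Fin.snoc (α := fun _ => X) q a := by
  funext t
  refine Fin.lastCases ?_ (fun i => ?_) t
  · simp [gluePrefix]
  · simp [gluePrefix]

theorem gluePrefix_eq_self (hj : j < M) {v : Fin M → X} (ha : v ⟨j, hj⟩ = a)
    (hb : ∀ i : Fin M, j < i.1 → v i = b i) :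
    gluePrefix j (fun i => v (i.castLE hj.le)) a b = v := by
  funext i
  rcases lt_trichotomy i.1 j with h | h | h
  · simp [gluePrefix, h]
  · obtain ⟨i, hi⟩ := i
    obtain rfl : i = j := h
    rw [gluePrefix_self, ha]
  · rw [gluePrefix_of_lt _ _ _ h, hb i h]

end gluePrefix


open Finset Classical in
theorem stmt8 {X S : Type*} [Fintype X] [Fintype S]
    (σ : X → Option S) (f : X → Option S → X → Option S)
    (hf : ∀ x x', f x none x' = none)
    (Sbar : (j : ℕ) → (Fin j → X) → Option S)
    (hSbar1 : ∀ x : Fin 1 → X, Sbar 1 x = σ (x 0))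
    (hSbarS : ∀ (j : ℕ) (x : Fin (j + 2) → X),
      Sbar (j + 2) x = f (x ((Fin.last j).castSucc))
        (Sbar (j + 1) (fun i => x i.castSucc)) (x (Fin.last (j + 1))))
    (η : ℝ) (hη : 0 < η) (M : ℕ) (hM : 1 ≤ M) (L : Fin M → X → ℝ)
    (w : Fin M → X → S → ℝ)
    (hw : ∀ (j : Fin M) (x : X) (s : S), w j x s =
      ∑ q : Fin j.1 → X,
        Real.exp (-η * (L j x + ∑ i : Fin j.1, L (i.castLE j.isLt.le) (q i))) *
          (if Sbar (j.1 + 1) (Fin.snoc q x) = some s then 1 else 0))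
    (hA : ∃ v : Fin M → X, Sbar M v ≠ none)
    (p : (Fin M → X) → ℝ)
    (hp : ∀ v, p v =
      (if Sbar M v ≠ none then Real.exp (-η * ∑ j, L j (v j)) else 0) /
        ∑ a : Fin M → X,
          (if Sbar M a ≠ none then Real.exp (-η * ∑ j, L j (a j)) else 0))
    (Sst : (Fin M → X) → Fin M → Option S)
    (hSst : ∀ (v : Fin M → X) (i : Fin M),
      Sst v i = Sbar (i.1 + 1) (fun t : Fin (i.1 + 1) => v (Fin.castLE i.isLt t)))
    (j : ℕ) (hj : j + 1 < M) (aSuf : Fin M → X) (sSuf : Fin M → S)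
    (hE : 0 < ∑ v ∈ Finset.univ.filter (fun v : Fin M → X =>
      ∀ i : Fin M, j < i.1 → (v i = aSuf i ∧ Sst v i = some (sSuf i))), p v)
    (a : X) (s : S) :
    (∑ v ∈ (Finset.univ.filter (fun v : Fin M → X =>
        ∀ i : Fin M, j < i.1 → (v i = aSuf i ∧ Sst v i = some (sSuf i)))).filter
          (fun v => v ⟨j, by omega⟩ = a ∧ Sst v ⟨j, by omega⟩ = some s), p v) /
      (∑ v ∈ Finset.univ.filter (fun v : Fin M → X =>
        ∀ i : Fin M, j < i.1 → (v i = aSuf i ∧ Sst v i = some (sSuf i))), p v) =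
    w ⟨j, by omega⟩ a s *
        (if f a (some s) (aSuf ⟨j + 1, hj⟩) = some (sSuf ⟨j + 1, hj⟩) then 1 else 0) /
      ∑ a' : X, ∑ s' : S, w ⟨j, by omega⟩ a' s' *
        (if f a' (some s') (aSuf ⟨j + 1, hj⟩) = some (sSuf ⟨j + 1, hj⟩) then 1 else 0) := by
  have hjM : j < M := by omega
  have hstep : ∀ (v : Fin M → X) (i : ℕ) (hi : i + 1 < M),
      Sst v ⟨i + 1, hi⟩ = f (v ⟨i, by omega⟩) (Sst v ⟨i, by omega⟩) (v ⟨i + 1, hi⟩) := by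
    intro v i hi
    rw [hSst, hSst, hSbarS]
    rfl
  have hlast : ∀ v : Fin M → X, Sbar M v = Sst v ⟨M - 1, by omega⟩ := by
    intro v
    rw [hSst]
    obtain ⟨m, rfl⟩ : ∃ m, M = m + 1 := ⟨M - 1, by omega⟩
    rfl
  set E := Finset.univ.filter (fun v : Fin M → X =>
      ∀ i : Fin M, j < i.1 → (v i = aSuf i ∧ Sst v i = some (sSuf i))) with hEdef
  have hmem : ∀ v, v ∈ E ↔
      ∀ i : Fin M, j < i.1 → (v i = aSuf i ∧ Sst v i = some (sSuf i)) := by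
    intro v
    simp [hEdef]
  obtain ⟨v₀, hv₀⟩ : E.Nonempty := by
    by_contra h
    rw [Finset.not_nonempty_iff_eq_empty] at h
    simp [h] at hE
  have hcons : ∀ (i : ℕ) (hi : i + 1 < M), j < i →
      f (aSuf ⟨i, by omega⟩) (some (sSuf ⟨i, by omega⟩)) (aSuf ⟨i + 1, hi⟩) =
        some (sSuf ⟨i + 1, hi⟩) := by
    intro i hi hji
    have h := (hmem v₀).1 hv₀
    have h₁ := h ⟨i, by omega⟩ hji
    have h₂ := h ⟨i + 1, hi⟩ (Nat.lt_succ_of_lt hji)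
    rw [← h₂.2, hstep, h₁.1, h₁.2, h₂.1]
  have hglue : ∀ q : Fin j → X, ∀ a,
      Sst (gluePrefix j q a aSuf) ⟨j, hjM⟩ = Sbar (j + 1) (Fin.snoc q a) := by
    intro q a
    rw [hSst]
    exact congrArg (Sbar (j + 1)) (gluePrefix_comp_castLE q a aSuf hjM)
  have hsuffix : ∀ (q : Fin j → X) (a : X) (s : S),
      Sbar (j + 1) (Fin.snoc q a) = some s →
      f a (some s) (aSuf ⟨j + 1, hj⟩) = some (sSuf ⟨j + 1, hj⟩) →
      gluePrefix j q a aSuf ∈ E := by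
    intro q a s hq hfs
    have key : ∀ i : ℕ, j + 1 ≤ i → ∀ hi : i < M,
        Sst (gluePrefix j q a aSuf) ⟨i, hi⟩ = some (sSuf ⟨i, hi⟩) := by
      intro i hji
      induction i, hji using Nat.le_induction with
      | base =>
        intro hi
        rw [hstep, hglue, hq, gluePrefix_self,
          gluePrefix_of_lt _ _ _ (i := ⟨j + 1, hi⟩) (Nat.lt_succ_self j), hfs]
      | succ i hji ih =>
        intro hi
        rw [hstep, ih, gluePrefix_of_lt _ _ _ (i := ⟨i, by omega⟩) hji,
          gluePrefix_of_lt _ _ _ (i := ⟨i + 1, hi⟩) (Nat.lt_succ_of_lt hji), hcons i hi hji]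
    exact (hmem _).2 fun i hi => ⟨gluePrefix_of_lt _ _ _ hi, key i.1 hi i.isLt⟩
  set Z := ∑ a : Fin M → X,
    (if Sbar M a ≠ none then Real.exp (-η * ∑ j, L j (a j)) else 0)
  set C := Real.exp (-η * ∑ i : Fin M, if j < i.1 then L i (aSuf i) else 0) / Z with hC
  have hpE : ∀ (q : Fin j → X) (a : X), gluePrefix j q a aSuf ∈ E →
      p (gluePrefix j q a aSuf) =
        C * Real.exp (-η * (L ⟨j, hjM⟩ a + ∑ i : Fin j, L (i.castLE hjM.le) (q i))) := by
    intro q a hqE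
    have hne : Sbar M (gluePrefix j q a aSuf) ≠ none := by
      rw [hlast, ((hmem _).1 hqE ⟨M - 1, by omega⟩ (by simp only; omega)).2]
      simp
    have htail : (∑ i : Fin M, if j < i.1 then L i (gluePrefix j q a aSuf i) else 0) =
        ∑ i : Fin M, if j < i.1 then L i (aSuf i) else 0 := by
      refine Finset.sum_congr rfl fun i _ => ?_
      split_ifs with h
      · rw [gluePrefix_of_lt _ _ _ h]
      · rfl
    rw [hp, if_pos hne, Fin.sum_univ_eq_add_sum_ite_lt j hjM, htail, gluePrefix_self]
    simp only [gluePrefix_castLE]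
    rw [mul_add, Real.exp_add, hC]
    ring
  have hfactor : ∀ (a : X) (s : S),
      ∑ v ∈ E.filter (fun v => v ⟨j, hjM⟩ = a ∧ Sst v ⟨j, hjM⟩ = some s), p v =
      C * (w ⟨j, hjM⟩ a s *
        (if f a (some s) (aSuf ⟨j + 1, hj⟩) = some (sSuf ⟨j + 1, hj⟩) then 1 else 0)) := by
    intro a s
    by_cases hfs : f a (some s) (aSuf ⟨j + 1, hj⟩) = some (sSuf ⟨j + 1, hj⟩)
    · rw [if_pos hfs, mul_one, hw, Finset.mul_sum]
      simp only [mul_ite, mul_one, mul_zero]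
      rw [← Finset.sum_filter]
      symm
      refine Finset.sum_bij' (fun q _ => gluePrefix j q a aSuf)
        (fun v _ => fun i => v (i.castLE hjM.le)) ?_ ?_ ?_ ?_ ?_
      · intro q hq
        have hq' := (Finset.mem_filter.1 hq).2
        exact Finset.mem_filter.2 ⟨hsuffix q a s hq' hfs, gluePrefix_self _ _ _ hjM,
          (hglue q a).trans hq'⟩
      · intro v hv
        obtain ⟨hvE, hva, hvs⟩ := Finset.mem_filter.1 hv
        refine Finset.mem_filter.2 ⟨Finset.mem_univ _, ?_⟩
        refine (hglue _ a).symm.trans ?_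
        rw [gluePrefix_eq_self a aSuf hjM hva fun i hi => ((hmem v).1 hvE i hi).1, hvs]
      · intro q _
        funext i
        exact gluePrefix_castLE q a aSuf hjM.le i
      · intro v hv
        obtain ⟨hvE, hva, -⟩ := Finset.mem_filter.1 hv
        exact gluePrefix_eq_self a aSuf hjM hva fun i hi => ((hmem v).1 hvE i hi).1
      · intro q hq
        exact (hpE q a (hsuffix q a s (Finset.mem_filter.1 hq).2 hfs)).symm
    · rw [if_neg hfs, mul_zero, mul_zero]
      refine Finset.sum_eq_zero fun v hv => absurd ?_ hfs
      obtain ⟨hvE, hva, hvs⟩ := Finset.mem_filter.1 hv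
      have h := (hmem v).1 hvE ⟨j + 1, hj⟩ (Nat.lt_succ_self j)
      rw [← h.2, hstep, hva, hvs, h.1]
  have htotal : ∑ v ∈ E, p v = ∑ a' : X, ∑ s' : S,
      ∑ v ∈ E.filter (fun v => v ⟨j, hjM⟩ = a' ∧ Sst v ⟨j, hjM⟩ = some s'), p v := by
    simp only [Finset.sum_filter]
    simp_rw [Finset.sum_comm (t := E)]
    refine Finset.sum_congr rfl fun v hvE => ?_
    have h := ((hmem v).1 hvE ⟨j + 1, hj⟩ (Nat.lt_succ_self j)).2
    obtain ⟨s₀, hs₀⟩ : ∃ s₀, Sst v ⟨j, hjM⟩ = some s₀ := by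
      rw [← Option.ne_none_iff_exists']
      intro hnone
      rw [hstep, hnone, hf] at h
      simp at h
    simp [hs₀, ite_and]
  have htotal' : ∑ v ∈ E, p v = C * ∑ a' : X, ∑ s' : S, w ⟨j, hjM⟩ a' s' *
      (if f a' (some s') (aSuf ⟨j + 1, hj⟩) = some (sSuf ⟨j + 1, hj⟩) then 1 else 0) := by
    rw [htotal]
    simp only [hfactor, Finset.mul_sum]
  have hC0 : C ≠ 0 := by
    intro h
    rw [htotal', h, zero_mul] at hE
    exact lt_irrefl _ hE
  rw [hfactor, htotal', mul_div_mul_left _ _ hC0]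
end

section
/- Let (A, F, μ) be a probability space, n ≥ 1, and let ℓ_1, ..., ℓ_n : A → [0,1] be measurable. Let η > 0 and for t = 1, ..., n let p_t be the probability measure on A with density dp_t/dμ (I) = exp(−η Σ_{s=1}^{t−1} ℓ_s(I)) / ∫_A exp(−η Σ_{s=1}^{t−1} ℓ_s(J)) dμ(J) (so p_1 = μ). Let I* ∈ A, ε > 0 and c ∈ (0,1], and assume μ{ I ∈ A : ℓ_s(I) ≤ ℓ_s(I*) + ε for all s = 1, ..., n } ≥ c. Then Σ_{t=1}^n ∫_A ℓ_t(I) dp_t(I) ≤ Σ_{t=1}^n ℓ_t(I*) + ε n + (1/η) ln(1/c) + η n / 8. -/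
open MeasureTheory ProbabilityTheory in
/-- Hoeffding's lemma for the log-partition function of an exponentially tilted measure. -/
lemma log_integral_exp_sub_le {A : Type*} [MeasurableSpace A] (μ : Measure A)
    [IsProbabilityMeasure μ] {f X : A → ℝ} (hf : Integrable (fun I => Real.exp (f I)) μ)
    (hX : Measurable X) (hX01 : ∀ I, X I ∈ Set.Icc (0 : ℝ) 1) (η : ℝ)
    (hfX : Integrable (fun I => Real.exp (f I - η * X I)) μ) :
    Real.log (∫ I, Real.exp (f I - η * X I) ∂μ) - Real.log (∫ I, Real.exp (f I) ∂μ)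
      ≤ -η * (∫ I, X I ∂(μ.tilted f)) + η ^ 2 / 8 := by
  have : IsProbabilityMeasure (μ.tilted f) := isProbabilityMeasure_tilted hf
  set m := ∫ I, X I ∂(μ.tilted f) with hm
  have hsub := (hasSubgaussianMGF_of_mem_Icc (μ := μ.tilted f) hX.aemeasurable
    (Filter.Eventually.of_forall hX01)).mgf_le (-η)
  have hmgf : mgf (fun I => X I - m) (μ.tilted f) (-η)
      = (∫ I, Real.exp (f I - η * X I) ∂μ) / (∫ I, Real.exp (f I) ∂μ) * Real.exp (η * m) := by
    have h := integral_exp_tilted (μ := μ) f (fun I => -η * X I)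
    rw [show (∫ I, Real.exp (f I - η * X I) ∂μ)
      = ∫ I, Real.exp ((f + fun I => -η * X I) I) ∂μ by simp [sub_eq_add_neg], ← h,
      ← integral_mul_const]
    refine integral_congr_ae (Filter.Eventually.of_forall fun I => ?_)
    simp only [← Real.exp_add]
    ring_nf
  rw [← hm, hmgf] at hsub
  have hpos := integral_exp_pos hf
  have hpos' := integral_exp_pos hfX
  have hlog := Real.log_le_log (by positivity) hsub
  rw [Real.log_mul (by positivity) (by positivity), Real.log_div hpos'.ne' hpos.ne',
    Real.log_exp, Real.log_exp] at hlog
  norm_num at hlog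
  linarith

open Finset MeasureTheory in
theorem stmt9 {A : Type*} [MeasurableSpace A] (μ : Measure A) [IsProbabilityMeasure μ]
    (n : ℕ) (hn : 1 ≤ n) (ℓ : Fin n → A → ℝ)
    (hmeas : ∀ t, Measurable (ℓ t)) (hbd : ∀ t I, ℓ t I ∈ Set.Icc (0:ℝ) 1)
    (η : ℝ) (hη : 0 < η)
    (Istar : A) (ε : ℝ) (hε : 0 < ε) (c : ℝ) (hc : c ∈ Set.Ioc (0:ℝ) 1)
    (hball : ENNReal.ofReal c ≤ μ {I | ∀ t, ℓ t I ≤ ℓ t Istar + ε}) :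
    ∑ t, ∫ I, ℓ t I ∂(μ.withDensity (fun I =>
        ENNReal.ofReal (Real.exp (-η * ∑ s ∈ Finset.Iio t, ℓ s I) /
          ∫ J, Real.exp (-η * ∑ s ∈ Finset.Iio t, ℓ s J) ∂μ)))
      ≤ ∑ t, ℓ t Istar + ε * n + (1 / η) * Real.log (1 / c) + η * n / 8 := by
  have hint (S : Finset (Fin n)) :
      Integrable (fun I => Real.exp (-η * ∑ s ∈ S, ℓ s I)) μ := by
    refine Integrable.of_bound (by fun_prop) 1 (Filter.Eventually.of_forall fun I => ?_)
    rw [Real.norm_eq_abs, Real.abs_exp, Real.exp_le_one_iff, neg_mul, neg_nonpos]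
    exact mul_nonneg hη.le (Finset.sum_nonneg fun s _ => (hbd s I).1)
  let past (k : ℕ) : Finset (Fin n) := univ.filter (fun s => (s : ℕ) < k)
  let G (k : ℕ) : ℝ := Real.log (∫ I, Real.exp (-η * ∑ s ∈ past k, ℓ s I) ∂μ)
  have hstep (t : Fin n) : G (t + 1) - G t ≤
      -η * (∫ I, ℓ t I ∂(μ.tilted fun I => -η * ∑ s ∈ Finset.Iio t, ℓ s I)) + η ^ 2 / 8 := by
    have hIio : past t = Finset.Iio t := by ext s; simp [past]
    have hsucc : past (t + 1) = insert t (Finset.Iio t) := by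
      ext s; simp [past]
    have hexp (I : A) : -η * ∑ s ∈ insert t (Finset.Iio t), ℓ s I
        = -η * ∑ s ∈ Finset.Iio t, ℓ s I - η * ℓ t I := by
      rw [Finset.sum_insert (by simp)]; ring
    have hi := hint (insert t (Finset.Iio t))
    simp only [G, hIio, hsucc]
    simp only [hexp] at hi ⊢
    exact log_integral_exp_sub_le μ (hint _) (hmeas t) (hbd t) η hi
  have htel : ∑ t : Fin n, (G (t + 1) - G t) = G n - G 0 := by
    rw [Fin.sum_univ_eq_sum_range (fun k => G (k + 1) - G k), Finset.sum_range_sub]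
  have hG0 : G 0 = 0 := by simp [G, past]
  have hpast : past n = univ := by ext s; simp [past]
  have hlower : Real.log c - η * (∑ t, ℓ t Istar + ε * n) ≤ G n := by
    set b := Real.exp (-η * (∑ t, ℓ t Istar + ε * n)) with hb
    have hmarkov := mul_meas_ge_le_integral_of_nonneg
      (Filter.Eventually.of_forall fun I => (Real.exp_pos _).le) (hint univ) b
    have hsubset : {I | ∀ t, ℓ t I ≤ ℓ t Istar + ε} ⊆
        {I | b ≤ Real.exp (-η * ∑ s, ℓ s I)} := by
      intro I hI
      have h : ∑ s, ℓ s I ≤ ∑ s, ℓ s Istar + ε * n := by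
        calc ∑ s, ℓ s I ≤ ∑ s, (ℓ s Istar + ε) := Finset.sum_le_sum fun s _ => hI s
          _ = ∑ s, ℓ s Istar + ε * n := by simp [Finset.sum_add_distrib, mul_comm]
      refine Real.exp_le_exp.2 ?_
      nlinarith
    have hcb : c ≤ μ.real {I | b ≤ Real.exp (-η * ∑ s, ℓ s I)} :=
      (ENNReal.ofReal_le_iff_le_toReal (measure_ne_top _ _)).1
        (hball.trans (measure_mono hsubset))
    have hbpos : 0 < b := Real.exp_pos _
    have hle := (mul_le_mul_of_nonneg_left hcb hbpos.le).trans hmarkov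
    have hlog := Real.log_le_log (mul_pos hbpos hc.1) hle
    rw [Real.log_mul hbpos.ne' hc.1.ne', hb, Real.log_exp] at hlog
    simp only [G, hpast]
    linarith
  have hsum := Finset.sum_le_sum fun t (_ : t ∈ (univ : Finset (Fin n))) => hstep t
  rw [htel, hG0, Finset.sum_add_distrib, ← Finset.mul_sum] at hsum
  simp only [Finset.sum_const, Finset.card_univ, Fintype.card_fin, nsmul_eq_mul] at hsum
  change ∑ t, ∫ I, ℓ t I ∂(μ.tilted fun I => -η * ∑ s ∈ Finset.Iio t, ℓ s I) ≤ _
  refine le_of_mul_le_mul_left ?_ hη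
  have hrhs : η * (∑ t, ℓ t Istar + ε * n + (1 / η) * Real.log (1 / c) + η * n / 8)
      = η * (∑ t, ℓ t Istar + ε * n) - Real.log c + n * (η ^ 2 / 8) := by
    rw [one_div c, Real.log_inv]
    field_simp
    ring
  rw [hrhs]
  linarith
end

section
/- Let X be a finite set, m ≥ 0 and ε > 0, and let I : [0,1] → X be a right-continuous step function with at most m shifts, i.e., there exist 0 = g_0 ≤ g_1 ≤ ... ≤ g_{m'} ≤ 1 with m' ≤ m such that I is constant on [g_j, g_{j+1}) for each j = 0, ..., m'−1 and on [g_{m'}, 1]. Then there exists a right-continuous step function I' : [0,1] → X with at most m shifts, all of whose shift points are integer multiples of ε, such that λ{ g ∈ [0,1] : I(g) ≠ I'(g) } ≤ m ε / 2, where λ denotes Lebesgue measure. -/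
open MeasureTheory ENNReal Classical

/-- The right-continuous step function on `ℝ` taking value `k j` on `[g_(j-1), g_(j))`
(with order statistics `g_(j)` of `g` and conventions `g_(0) = -∞`-side start, `g_(m+1) = ∞`):
its value at `t` is `k` applied to the number of points `g i` that are `≤ t`. -/
noncomputable def stepFn {α : Type*} {m : ℕ} (g : Fin m → ℝ) (k : Fin (m + 1) → α) : ℝ → α :=
  fun t => k ⟨(Finset.univ.filter fun i => g i ≤ t).card, by
    exact Nat.lt_succ_of_le (by simpa using Finset.card_filter_le Finset.univ fun i => g i ≤ t)⟩

/-- The set of simultaneous actions with at most `m` shifts: functions that agree on `[0,1]`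
with a right-continuous step function having at most `m` shift points, all in `[0,1]`. -/
def AtMostShifts {α : Type*} (m : ℕ) : Set (ℝ → α) :=
  {I | ∃ m' ≤ m, ∃ g : Fin m' → ℝ, ∃ k : Fin (m' + 1) → α,
    Monotone g ∧ (∀ i, g i ∈ Set.Icc (0:ℝ) 1) ∧
      ∀ t ∈ Set.Icc (0:ℝ) 1, I t = stepFn g k t}

/-- The subset of step functions with at most `m` shifts whose shift points are all
integer multiples of `ε`. -/
def GridStep {α : Type*} (m : ℕ) (ε : ℝ) : Set (ℝ → α) :=
  {I | ∃ m' ≤ m, ∃ g : Fin m' → ℝ, ∃ k : Fin (m' + 1) → α,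
    Monotone g ∧ (∀ i, g i ∈ Set.Icc (0:ℝ) 1) ∧ (∀ i, ∃ j : ℕ, g i = j * ε) ∧
      I = stepFn g k}

/-- The distribution `μ` on simultaneous actions with at most `m` shifts, obtained as the
pushforward, by the map producing the step function, of the product of the uniform
distribution on the `m+1` actions and the Lebesgue measure on `[0,1]^m`. -/
noncomputable def contMeasure (N m : ℕ) : Measure (ℝ → Fin N) :=
  Measure.map (fun q : (Fin (m + 1) → Fin N) × (Fin m → ℝ) => stepFn q.2 q.1)
    ((((Fintype.card (Fin (m + 1) → Fin N) : ℝ≥0∞))⁻¹ •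
        (Measure.count : Measure (Fin (m + 1) → Fin N))).prod
      (volume.restrict {g : Fin m → ℝ | ∀ i, g i ∈ Set.Icc (0:ℝ) 1}))

/-- A step function may only change value at points lying between an old and a new shift. -/
theorem stepFn_congr {α : Type*} {m : ℕ} {g r : Fin m → ℝ} (k : Fin (m + 1) → α) {t : ℝ}
    (h : ∀ i, g i ≤ t ↔ r i ≤ t) : stepFn g k t = stepFn r k t := by
  simp only [stepFn, h]

/-- Below the level `b`, a step function with monotone shifts agrees with one all of whose shifts
are at most `b`. -/
theorem exists_stepFn_eq_of_le {α : Type*} {m : ℕ} {r : Fin m → ℝ} (hr : Monotone r)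
    (k : Fin (m + 1) → α) (b : ℝ) :
    ∃ p, ∃ hp : p ≤ m, ∃ k' : Fin (p + 1) → α,
      (∀ i : Fin p, r (Fin.castLE hp i) ≤ b) ∧
        ∀ t ≤ b, stepFn r k t = stepFn (fun i => r (Fin.castLE hp i)) k' t := by
  have hp : (Finset.univ.filter fun i => r i ≤ b).card ≤ m := by
    simpa using Finset.card_filter_le Finset.univ fun i => r i ≤ b
  refine ⟨_, hp, fun j => k (Fin.castLE (Nat.succ_le_succ hp) j), fun i => ?_, fun t ht => ?_⟩
  · by_contra hi
    have hsub : (Finset.univ.filter fun j => r j ≤ b) ⊆ Finset.Iio (Fin.castLE hp i) := by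
      intro j hj
      rw [Finset.mem_Iio]
      by_contra hij
      exact hi ((hr (not_lt.mp hij)).trans (Finset.mem_filter.mp hj).2)
    have hcard := Finset.card_le_card hsub
    rw [Fin.card_Iio] at hcard
    exact absurd i.isLt (not_lt.mpr hcard)
  · simp only [stepFn]
    congr 1
    ext
    simp only [Fin.val_castLE]
    symm
    rw [← Finset.card_map (Fin.castLEEmb hp)]
    congr 1
    ext i
    simp only [Finset.mem_map, Finset.mem_filter, Finset.mem_univ, true_and]
    constructor
    · rintro ⟨j, hj, rfl⟩
      exact hj
    · intro hi
      have hsub : Finset.Iic i ⊆ (Finset.univ.filter fun j => r j ≤ b) := by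
        intro j hj
        rw [Finset.mem_filter]
        exact ⟨Finset.mem_univ _, (hr (Finset.mem_Iic.mp hj)).trans (hi.trans ht)⟩
      have hcard := Finset.card_le_card hsub
      rw [Fin.card_Iic] at hcard
      exact ⟨⟨i, hcard⟩, hi, rfl⟩

/-- Moving each of the `m` shifts by at most `δ` changes a step function on a set of measure at
most `m * δ`. -/
theorem volume_stepFn_ne_le {α : Type*} {m : ℕ} {g r : Fin m → ℝ} (k : Fin (m + 1) → α) {δ : ℝ}
    (h : ∀ i, |g i - r i| ≤ δ) :
    volume {t | stepFn g k t ≠ stepFn r k t} ≤ ENNReal.ofReal (m * δ) := by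
  have hsub : {t | stepFn g k t ≠ stepFn r k t} ⊆
      ⋃ i, Set.Ico (min (g i) (r i)) (max (g i) (r i)) := by
    intro t ht
    by_contra hn
    refine ht (stepFn_congr k fun i => ?_)
    have hi : t ∉ Set.Ico (min (g i) (r i)) (max (g i) (r i)) :=
      fun hi => hn (Set.mem_iUnion.mpr ⟨i, hi⟩)
    simp only [Set.mem_Ico, min_le_iff, lt_max_iff] at hi
    grind
  calc volume {t | stepFn g k t ≠ stepFn r k t}
      ≤ ∑ i, volume (Set.Ico (min (g i) (r i)) (max (g i) (r i))) :=
        (measure_mono hsub).trans (measure_iUnion_fintype_le _ _)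
    _ ≤ ∑ _i : Fin m, ENNReal.ofReal δ := by
        refine Finset.sum_le_sum fun i _ => ?_
        rw [Real.volume_Ico, max_sub_min_eq_abs']
        exact ENNReal.ofReal_le_ofReal (h i)
    _ = ENNReal.ofReal (m * δ) := by
        rw [Finset.sum_const, Finset.card_univ, Fintype.card_fin, nsmul_eq_mul,
          ENNReal.ofReal_mul (Nat.cast_nonneg m), ENNReal.ofReal_natCast]

/-- The nearest multiple of `ε` is at distance at most `ε / 2`. -/
theorem abs_sub_round_div_mul_le {ε : ℝ} (hε : 0 < ε) (x : ℝ) :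
    |x - round (x / ε) * ε| ≤ ε / 2 := by
  have h : x - round (x / ε) * ε = (x / ε - round (x / ε)) * ε := by
    field_simp
  rw [h, abs_mul, abs_of_pos hε]
  nlinarith [abs_sub_round (x / ε)]

theorem stmt14 {X : Type*} [Fintype X] [Nonempty X] (m : ℕ) (ε : ℝ) (hε : 0 < ε)
    (I : ℝ → X) (hI : I ∈ AtMostShifts m) :
    ∃ I' ∈ GridStep (α := X) m ε,
      volume {t ∈ Set.Icc (0:ℝ) 1 | I t ≠ I' t} ≤ ENNReal.ofReal (m * ε / 2) := by
  obtain ⟨n, hn, g, k, hg, hg01, hI⟩ := hI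
  have hround : Monotone (round : ℝ → ℤ) := fun x y hxy => by
    rw [round_eq, round_eq]
    exact Int.floor_mono (by linarith)
  have hr : Monotone fun i => (round (g i / ε) : ℝ) * ε := fun i j hij =>
    mul_le_mul_of_nonneg_right
      (Int.cast_le.mpr (hround (div_le_div_of_nonneg_right (hg hij) hε.le))) hε.le
  have hr0 : ∀ i, 0 ≤ round (g i / ε) := fun i => by
    simpa using hround (div_nonneg (hg01 i).1 hε.le)
  obtain ⟨p, hp, k', hle, heq⟩ := exists_stepFn_eq_of_le hr k 1
  refine ⟨_, ⟨p, hp.trans hn, _, k', fun i j hij => hr (Fin.castLE_le_castLE_iff hp |>.mpr hij),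
    fun i => ⟨mul_nonneg (Int.cast_nonneg (hr0 _)) hε.le, hle i⟩,
    fun i => ⟨(round (g (Fin.castLE hp i) / ε)).toNat, ?_⟩, rfl⟩, ?_⟩
  · have h := Int.toNat_of_nonneg (hr0 (Fin.castLE hp i))
    have hcast : ((round (g (Fin.castLE hp i) / ε)).toNat : ℝ) =
        (round (g (Fin.castLE hp i) / ε) : ℝ) := by exact_mod_cast h
    rw [hcast]
  · refine (measure_mono ?_).trans ((volume_stepFn_ne_le k
      fun i => abs_sub_round_div_mul_le hε (g i)).trans (ENNReal.ofReal_le_ofReal ?_))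
    · rintro t ⟨ht, hne⟩
      rw [hI t ht, ← heq t ht.2] at hne
      exact hne
    · rw [mul_div_assoc]
      exact mul_le_mul_of_nonneg_right (Nat.cast_le.mpr hn) (by positivity)
end
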